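/- Suppose that along a sequence p_n → +∞ the limit l = lim s_{p_n}/ε_{p_n}⁺ exists in [0,+∞]. Then 0 < l < +∞, (r_{p_n} − s_{p_n})/ε_{p_n}⁺ → −l, and the rescaled functions z_{p_n}⁺(r) = (p_n/u_{p_n}(s_{p_n}))·(u_{p_n}(s_{p_n} + ε_{p_n}⁺ r) − u_{p_n}(s_{p_n})), defined on ((r_{p_n}−s_{p_n})/ε_{p_n}⁺, (1−s_{p_n})/ε_{p_n}⁺), converge in C¹_loc((−l, +∞)) to the function z̃_l(r) = Z_l(r + l). -/

import Mathlib

open Real MeasureTheory Set Filter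

noncomputable section

/-- The radial energy functional for the Lane–Emden problem on the unit ball of `ℝ²`
(written in polar coordinates; the common factor `2π` is dropped). -/
def radialEnergy (p : ℝ) (v : ℝ → ℝ) : ℝ :=
  (1 / 2) * (∫ r in (0:ℝ)..1, (deriv v r) ^ 2 * r)
    - (1 / (p + 1)) * ∫ r in (0:ℝ)..1, |v r| ^ (p + 1) * r

/-- The Nehari identity `∫_B |∇v⁺|² = ∫_B |v⁺|^{p+1}` for the positive part,
written in polar coordinates. -/
def nehariPos (p : ℝ) (v : ℝ → ℝ) : Prop :=
  (∫ r in (0:ℝ)..1, (if 0 < v r then (deriv v r) ^ 2 * r else 0))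
    = ∫ r in (0:ℝ)..1, (max (v r) 0) ^ (p + 1) * r

/-- The Nehari identity `∫_B |∇v⁻|² = ∫_B |v⁻|^{p+1}` for the negative part,
written in polar coordinates. -/
def nehariNeg (p : ℝ) (v : ℝ → ℝ) : Prop :=
  (∫ r in (0:ℝ)..1, (if v r < 0 then (deriv v r) ^ 2 * r else 0))
    = ∫ r in (0:ℝ)..1, (max (-v r) 0) ^ (p + 1) * r

/-- A family `p ↦ u p` (for `p > 1`) of least energy nodal radial solutions of the
Lane–Emden problem `−Δu = |u|^{p−1}u` in the unit ball `B ⊆ ℝ²`, `u = 0` on `∂B`,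
described through the radial profile `u p : ℝ → ℝ`.  `rp p ∈ (0,1)` is the nodal
radius, `sp p ∈ (rp p, 1)` is a radius where `u p` attains `‖(u p)⁺‖_∞`; the solution
is negative in the inner nodal region (`u p 0 < 0`), attains `-‖(u p)⁻‖_∞` at `0`,
and minimizes the energy among radial members of the nodal Nehari set. -/
structure LaneEmdenFamily where
  u : ℝ → ℝ → ℝ
  rp : ℝ → ℝ
  sp : ℝ → ℝ
  smooth : ∀ p, 1 < p → ContDiffOn ℝ 2 (u p) (Icc (0:ℝ) 1)
  ode : ∀ p, 1 < p → ∀ r ∈ Ioo (0:ℝ) 1,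
    -deriv (deriv (u p)) r - deriv (u p) r / r = |u p r| ^ (p - 1) * u p r
  derivAtZero : ∀ p, 1 < p → deriv (u p) 0 = 0
  boundary : ∀ p, 1 < p → u p 1 = 0
  center_neg : ∀ p, 1 < p → u p 0 < 0
  min_at_zero : ∀ p, 1 < p → ∀ r ∈ Icc (0:ℝ) 1, u p 0 ≤ u p r
  rp_mem : ∀ p, 1 < p → rp p ∈ Ioo (0:ℝ) 1
  rp_zero : ∀ p, 1 < p → u p (rp p) = 0
  neg_in : ∀ p, 1 < p → ∀ r ∈ Ico (0:ℝ) (rp p), u p r < 0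
  pos_out : ∀ p, 1 < p → ∀ r ∈ Ioo (rp p) 1, 0 < u p r
  sp_mem : ∀ p, 1 < p → sp p ∈ Ioo (rp p) 1
  sp_max : ∀ p, 1 < p → ∀ r ∈ Icc (0:ℝ) 1, u p r ≤ u p (sp p)
  least_energy : ∀ p, 1 < p → ∀ v : ℝ → ℝ,
    ContDiffOn ℝ 1 v (Icc (0:ℝ) 1) → v 1 = 0 →
    (∃ r ∈ Ioo (0:ℝ) 1, 0 < v r) → (∃ r ∈ Ioo (0:ℝ) 1, v r < 0) →
    nehariPos p v → nehariNeg p v →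
    radialEnergy p (u p) ≤ radialEnergy p v

/-- `ε_p⁺`, defined by `(ε_p⁺)⁻² = p · ‖u_p⁺‖_∞^{p−1} = p · u_p(s_p)^{p−1}`. -/
def epsP (F : LaneEmdenFamily) (p : ℝ) : ℝ :=
  1 / Real.sqrt (p * F.u p (F.sp p) ^ (p - 1))

/-- `ε_p⁻`, defined by `(ε_p⁻)⁻² = p · ‖u_p⁻‖_∞^{p−1} = p · |u_p(0)|^{p−1}`. -/
def epsM (F : LaneEmdenFamily) (p : ℝ) : ℝ :=
  1 / Real.sqrt (p * (-F.u p 0) ^ (p - 1))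

/-- `α = √(2l² + 4)`. -/
def alphaOf (l : ℝ) : ℝ := Real.sqrt (2 * l ^ 2 + 4)

/-- `β = ((α+2)/(α−2))^{1/α} · l`. -/
def betaOf (l : ℝ) : ℝ := ((alphaOf l + 2) / (alphaOf l - 2)) ^ (1 / alphaOf l) * l

/-- The singular Liouville profile `Z_l(r) = log(2α²β^α r^{α−2}/(β^α + r^α)²)`. -/
def Zl (l : ℝ) (r : ℝ) : ℝ :=
  Real.log (2 * alphaOf l ^ 2 * betaOf l ^ alphaOf l * r ^ (alphaOf l - 2)
    / (betaOf l ^ alphaOf l + r ^ alphaOf l) ^ 2)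

/-- The rescaling `z_p⁺(r) = (p/u_p(s_p))·(u_p(s_p + ε_p⁺ r) − u_p(s_p))`. -/
def zPlus (F : LaneEmdenFamily) (p : ℝ) (r : ℝ) : ℝ :=
  (p / F.u p (F.sp p)) * (F.u p (F.sp p + epsP F p * r) - F.u p (F.sp p))


/-- A function with nonnegative derivative on `(a, b)`, continuous on `[a, b]`, satisfies
`f a ≤ f b`. -/
lemma le_of_hasDerivAt_nonneg {f f' : ℝ → ℝ} {a b : ℝ} (hab : a ≤ b)
    (hc : ContinuousOn f (Icc a b)) (hd : ∀ x ∈ Ioo a b, HasDerivAt f (f' x) x)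
    (h : ∀ x ∈ Ioo a b, 0 ≤ f' x) : f a ≤ f b := by
  refine monotoneOn_of_deriv_nonneg (convex_Icc a b) hc ?_ ?_ (left_mem_Icc.2 hab)
    (right_mem_Icc.2 hab) hab
  · rw [interior_Icc]
    exact fun x hx => (hd x hx).differentiableAt.differentiableWithinAt
  · rw [interior_Icc]
    intro x hx
    rw [(hd x hx).deriv]
    exact h x hx

/-- A solution `y` of `y'' + Λ e^{κ t} (1 + y / p) ^ p = 0`, `y 0 = y' 0 = 0`, on `[0, R]`, which
stays in `[-p, 0]` and reaches `-p` at `R`. -/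
structure IsHalfProfile (p Λ κ R : ℝ) (y y' : ℝ → ℝ) : Prop where
  R_pos : 0 < R
  cont : ContinuousOn y (Icc 0 R)
  zero : y 0 = 0
  zero' : y' 0 = 0
  last : y R = -p
  mem : ∀ t ∈ Icc 0 R, y t ∈ Icc (-p) 0
  hasDeriv : ∀ t ∈ Ico 0 R, HasDerivAt y (y' t) t
  hasDeriv' : ∀ t ∈ Ico 0 R,
    HasDerivAt y' (-(Λ * Real.exp (κ * t) * (1 + y t / p) ^ p)) t

lemma rpow_one_add_div_mem {p y : ℝ} (hp : 0 < p) (hy : y ∈ Icc (-p) 0) :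
    (1 + y / p) ^ p ∈ Icc (0 : ℝ) 1 := by
  have h1 : -1 ≤ y / p := by rw [le_div_iff₀ hp]; linarith [hy.1]
  have h2 : y / p ≤ 0 := div_nonpos_of_nonpos_of_nonneg hy.2 hp.le
  exact ⟨Real.rpow_nonneg (by linarith) _, Real.rpow_le_one (by linarith) (by linarith) hp.le⟩

lemma rpow_one_add_div_le_exp {p y : ℝ} (hp : 0 < p) (hy : y ∈ Icc (-p) 0) :
    (1 + y / p) ^ p ≤ Real.exp y := by
  have h1 : -1 ≤ y / p := by rw [le_div_iff₀ hp]; linarith [hy.1]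
  calc (1 + y / p) ^ p ≤ (Real.exp (y / p)) ^ p :=
        Real.rpow_le_rpow (by linarith) (by linarith [Real.add_one_le_exp (y / p)]) hp.le
    _ = Real.exp y := by rw [← Real.exp_mul, div_mul_cancel₀ _ hp.ne']

lemma exp_sub_le_rpow_one_add_div {p y C : ℝ} (hp : 0 < p) (hC : 2 * C ≤ p)
    (hy : y ∈ Icc (-C) 0) : Real.exp y - 2 * C ^ 2 / p ≤ (1 + y / p) ^ p := by
  have h1 : -(1 / 2) ≤ y / p := by rw [le_div_iff₀ hp]; linarith [hy.1]
  have h2 : y / p ≤ 0 := div_nonpos_of_nonpos_of_nonneg hy.2 hp.le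
  have h0 : 0 < 1 + y / p := by linarith
  have hlog : y / p - 2 * (y / p) ^ 2 ≤ Real.log (1 + y / p) := by
    refine le_trans ?_ (Real.one_sub_inv_le_log_of_pos h0)
    have h3 : (1 + y / p)⁻¹ * (1 + y / p) = 1 := inv_mul_cancel₀ h0.ne'
    have h4 : (1 + y / p)⁻¹ ≤ 2 := by
      rw [inv_le_comm₀ h0 two_pos]; linarith
    nlinarith [sq_nonneg (y / p)]
  have hexp : Real.exp (y - 2 * y ^ 2 / p) ≤ (1 + y / p) ^ p := by
    rw [Real.rpow_def_of_pos h0, Real.exp_le_exp]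
    calc y - 2 * y ^ 2 / p = (y / p - 2 * (y / p) ^ 2) * p := by field_simp
      _ ≤ _ := by gcongr
  have hy2 : 2 * y ^ 2 / p ≤ 2 * C ^ 2 / p := by
    have : y ^ 2 ≤ C ^ 2 := by nlinarith [hy.1, hy.2]
    gcongr
  have h3 := Real.add_one_le_exp (-(2 * y ^ 2 / p))
  have h4 : Real.exp y ≤ 1 := Real.exp_le_one_iff.2 hy.2
  have h5 : 0 ≤ 2 * y ^ 2 / p := by positivity
  rw [sub_eq_add_neg, Real.exp_add] at hexp
  nlinarith [Real.exp_pos y]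

lemma IsHalfProfile.lower_bound' {p Λ κ R M t : ℝ} {y y' : ℝ → ℝ}
    (h : IsHalfProfile p Λ κ R y y') (hp : 0 < p) (hM : ∀ x ∈ Ioo 0 t, Λ * Real.exp (κ * x) ≤ M)
    (hΛ : 0 ≤ Λ) (ht : t ∈ Ico 0 R) : -(M * t) ≤ y' t := by
  have key := le_of_hasDerivAt_nonneg (f := fun x => y' x + M * x)
    (f' := fun x => -(Λ * Real.exp (κ * x) * (1 + y x / p) ^ p) + M * 1) ht.1 ?_ ?_ ?_
  · simp only [h.zero', mul_zero, add_zero] at key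
    linarith
  · intro x hx
    exact ((h.hasDeriv' x ⟨hx.1, hx.2.trans_lt ht.2⟩).continuousAt.add
      (by fun_prop)).continuousWithinAt
  · intro x hx
    exact (h.hasDeriv' x ⟨hx.1.le, hx.2.trans ht.2⟩).add ((hasDerivAt_id x).const_mul M)
  · intro x hx
    have h1 := rpow_one_add_div_mem hp (h.mem x ⟨hx.1.le, (hx.2.trans ht.2).le⟩)
    have h2 := hM x hx
    have h3 : 0 ≤ Λ * Real.exp (κ * x) := by positivity
    nlinarith [h1.1, h1.2]

lemma IsHalfProfile.lower_bound {p Λ κ R M t : ℝ} {y y' : ℝ → ℝ}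
    (h : IsHalfProfile p Λ κ R y y') (hp : 0 < p) (hM : ∀ x ∈ Ioo 0 t, Λ * Real.exp (κ * x) ≤ M)
    (hΛ : 0 ≤ Λ) (ht : t ∈ Icc 0 R) : -(M * t ^ 2 / 2) ≤ y t := by
  have key := le_of_hasDerivAt_nonneg (f := fun x => y x + M / 2 * x ^ 2)
    (f' := fun x => y' x + M / 2 * (2 * x)) ht.1 ?_ ?_ ?_
  · simp only [h.zero] at key
    linarith
  · exact (h.cont.mono (Icc_subset_Icc_right ht.2)).add (by fun_prop)
  · intro x hx
    refine (h.hasDeriv x ⟨hx.1.le, hx.2.trans_le ht.2⟩).add ?_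
    simpa using ((hasDerivAt_pow 2 x).const_mul (M / 2))
  · intro x hx
    have := h.lower_bound' hp (fun z hz => hM z ⟨hz.1, hz.2.trans hx.2⟩) hΛ
      ⟨hx.1.le, hx.2.trans_le ht.2⟩
    linarith

/-- The derivative of a half profile at the end point, for weight `e^{-2t}`, is at most `Λ / 2`
in absolute value. -/
lemma IsHalfProfile.neg_deriv_le {p Λ R : ℝ} {y y' : ℝ → ℝ}
    (h : IsHalfProfile p Λ (-2) R y y') (hp : 0 < p) (hΛ : 0 ≤ Λ)
    (hc : ContinuousOn y' (Icc 0 R)) : -y' R ≤ Λ / 2 := by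
  have key := le_of_hasDerivAt_nonneg (f := fun x => y' x + Λ * (-(Real.exp (-2 * x)) / 2))
    (f' := fun x => -(Λ * Real.exp (-2 * x) * (1 + y x / p) ^ p) +
      Λ * (-(Real.exp (-2 * x) * (-2 * 1)) / 2)) h.R_pos.le ?_ ?_ ?_
  · simp only [h.zero', mul_zero, Real.exp_zero] at key
    have : 0 ≤ Λ * Real.exp (-2 * R) := by positivity
    linarith
  · exact hc.add (by fun_prop)
  · intro x hx
    refine (h.hasDeriv' x ⟨hx.1.le, hx.2⟩).add ?_
    exact ((((hasDerivAt_id x).const_mul (-2)).exp.neg).div_const 2).const_mul Λ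
  · intro x hx
    have h1 := rpow_one_add_div_mem hp (h.mem x ⟨hx.1.le, hx.2.le⟩)
    have h3 : 0 ≤ Λ * Real.exp (-2 * x) := by positivity
    nlinarith [h1.1, h1.2]

lemma IsHalfProfile.le_neg_deriv {p L R : ℝ} {y y' : ℝ → ℝ}
    (h : IsHalfProfile p (L ^ 2) (-2) R y y') (hp : 1 ≤ p) (hL : 1 ≤ L)
    (hc : ContinuousOn y' (Icc 0 R)) :
    Real.exp (-2) * L / 2 ≤ -y' R ∧ R ≤ 1 + 2 * Real.exp 2 * p := by
  have hp0 : 0 < p := by linarith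
  have hL0 : 0 < L := by linarith
  have hL1 : 1 / L ≤ 1 := by rw [div_le_one hL0]; exact hL
  have hL2 : 0 < 1 / L := by positivity
  have hLL : L * (1 / L) = 1 := by field_simp
  have hM : ∀ x : ℝ, 0 < x → L ^ 2 * Real.exp (-2 * x) ≤ L ^ 2 := by
    intro x hx
    have : Real.exp (-2 * x) ≤ 1 := Real.exp_le_one_iff.2 (by linarith)
    nlinarith [sq_nonneg L]
  have hR : 1 / L < R := by
    by_contra! hR
    have h1 := h.lower_bound hp0 (fun x hx => hM x hx.1) (sq_nonneg L)
      (right_mem_Icc.2 h.R_pos.le)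
    rw [h.last] at h1
    have h2 : L * R ≤ 1 := by rw [← hLL]; gcongr
    have h3 : 0 ≤ L * R := mul_nonneg hL0.le h.R_pos.le
    nlinarith
  have hy : ∀ x ∈ Icc 0 (1 / L), (1 : ℝ) / 2 ≤ (1 + y x / p) ^ p := by
    intro x hx
    have h1 := h.lower_bound hp0 (t := x) (fun z hz => hM z hz.1) (sq_nonneg L)
      ⟨hx.1, hx.2.trans hR.le⟩
    have h2 : L * x ≤ 1 := by rw [← hLL]; gcongr; exact hx.2
    have h3 : 0 ≤ L * x := mul_nonneg hL0.le hx.1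
    have h4 : -(1 / 2) ≤ y x := by nlinarith
    have h5 : -1 ≤ y x / p := by rw [le_div_iff₀ hp0]; linarith
    have := one_add_mul_self_le_rpow_one_add h5 hp
    rw [mul_div_cancel₀ _ hp0.ne'] at this
    linarith
  have hmid : Real.exp (-2) * L / 2 ≤ -y' (1 / L) := by
    have key := le_of_hasDerivAt_nonneg (f := fun x => -y' x + -(L ^ 2 * Real.exp (-2) / 2 * x))
      (f' := fun x => -(-(L ^ 2 * Real.exp (-2 * x) * (1 + y x / p) ^ p)) +
        -(L ^ 2 * Real.exp (-2) / 2 * 1)) hL2.le ?_ ?_ ?_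
    · simp only [h.zero', mul_zero] at key
      have : L ^ 2 * Real.exp (-2) / 2 * (1 / L) = Real.exp (-2) * L / 2 := by field_simp
      linarith
    · exact (hc.mono (Icc_subset_Icc_right hR.le)).neg.add (by fun_prop)
    · intro x hx
      exact (h.hasDeriv' x ⟨hx.1.le, hx.2.trans hR⟩).neg.add
        (((hasDerivAt_id x).const_mul _).neg)
    · intro x hx
      have h1 := hy x ⟨hx.1.le, hx.2.le⟩
      have h2 : Real.exp (-2) ≤ Real.exp (-2 * x) := Real.exp_le_exp.2 (by linarith [hx.2])
      have h3 : 0 < Real.exp (-2) := Real.exp_pos _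
      have h4 : Real.exp (-2) * (1 / 2) ≤ Real.exp (-2 * x) * (1 + y x / p) ^ p := by gcongr
      nlinarith [sq_nonneg L]
  have hanti : ∀ x ∈ Icc (1 / L) R, Real.exp (-2) * L / 2 ≤ -y' x := by
    intro x hx
    refine hmid.trans ?_
    refine le_of_hasDerivAt_nonneg (f := fun x => -y' x)
      (f' := fun x => -(-(L ^ 2 * Real.exp (-2 * x) * (1 + y x / p) ^ p))) hx.1 ?_ ?_ ?_
    · exact (hc.mono (Icc_subset_Icc hL2.le hx.2)).neg
    · intro z hz
      exact (h.hasDeriv' z ⟨hL2.le.trans hz.1.le, hz.2.trans_le hx.2⟩).neg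
    · intro z hz
      have h1 := rpow_one_add_div_mem hp0
        (h.mem z ⟨hL2.le.trans hz.1.le, (hz.2.trans_le hx.2).le⟩)
      have := h1.1
      rw [neg_neg]; positivity
  refine ⟨hanti R ⟨hR.le, le_rfl⟩, ?_⟩
  have key := le_of_hasDerivAt_nonneg (f := fun x => -y x + -(Real.exp (-2) * L / 2 * x))
      (f' := fun x => -y' x + -(Real.exp (-2) * L / 2 * 1)) hR.le ?_ ?_ ?_
  · simp only [h.last] at key
    have h1 := (h.mem (1 / L) ⟨hL2.le, hR.le⟩).2
    have h2 : Real.exp (-2) * L / 2 * (R - 1 / L) ≤ p := by linarith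
    have h3 : Real.exp (-2) / 2 * (R - 1 / L) ≤ p := by
      refine le_trans ?_ h2
      have : 0 ≤ Real.exp (-2) / 2 * (R - 1 / L) :=
        mul_nonneg (by positivity) (by linarith)
      nlinarith
    have h4 : R - 1 / L ≤ 2 * Real.exp 2 * p := by
      have h5 : Real.exp 2 * Real.exp (-2) = 1 := by rw [← Real.exp_add]; simp
      have h6 := mul_le_mul_of_nonneg_left h3 (by positivity : 0 ≤ 2 * Real.exp 2)
      calc R - 1 / L = Real.exp 2 * Real.exp (-2) * (R - 1 / L) := by rw [h5, one_mul]
        _ = 2 * Real.exp 2 * (Real.exp (-2) / 2 * (R - 1 / L)) := by ring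
        _ ≤ _ := h6
    linarith
  · exact (h.cont.mono (Icc_subset_Icc_left hL2.le)).neg.add (by fun_prop)
  · intro x hx
    exact (h.hasDeriv x ⟨hL2.le.trans hx.1.le, hx.2⟩).neg.add
        (((hasDerivAt_id x).const_mul _).neg)
  · intro x hx
    have := hanti x ⟨hx.1.le, hx.2.le⟩
    linarith

/-- Grönwall comparison of a half profile with the corresponding solution of the Liouville
equation. -/
lemma IsHalfProfile.abs_sub_le {p Λ κ R C M b lam : ℝ} {y y' Y Y' : ℝ → ℝ}
    (h : IsHalfProfile p Λ κ R y y') (hp : 0 < p) (hC : 2 * C ≤ p) (hb : b < R)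
    (hyC : ∀ t ∈ Icc 0 b, -C ≤ y t) (hlam : 0 ≤ lam)
    (hM : ∀ t ∈ Icc 0 b, Real.exp (κ * t) ≤ M)
    (hY0 : Y 0 = 0) (hY0' : Y' 0 = 0) (hYneg : ∀ t ∈ Icc 0 b, Y t ≤ 0)
    (hY : ∀ t ∈ Icc 0 b, HasDerivAt Y (Y' t) t)
    (hY' : ∀ t ∈ Icc 0 b, HasDerivAt Y' (-(lam * Real.exp (κ * t) * Real.exp (Y t))) t) :
    ∀ t ∈ Icc 0 b, max |Y t - y t| |Y' t - y' t| ≤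
      gronwallBound 0 (max 1 (lam * M)) (M * (|Λ - lam| + lam * (2 * C ^ 2 / p))) b := by
  intro t ht
  have hb0 : 0 ≤ b := ht.1.trans ht.2
  have hM1 : 0 ≤ M := (Real.exp_pos _).le.trans (hM 0 ⟨le_rfl, hb0⟩)
  have hK : (0 : ℝ) ≤ max 1 (lam * M) := le_max_of_le_left zero_le_one
  have hε : 0 ≤ M * (|Λ - lam| + lam * (2 * C ^ 2 / p)) := by positivity
  have hIco : ∀ x ∈ Icc 0 b, x ∈ Ico 0 R := fun x hx => ⟨hx.1, hx.2.trans_lt hb⟩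
  have key := dist_le_of_approx_trajectories_ODE_of_mem
    (f := fun t => (Y t, Y' t)) (g := fun t => (y t, y' t))
    (f' := fun t => (Y' t, -(lam * Real.exp (κ * t) * Real.exp (Y t))))
    (g' := fun t => (y' t, -(Λ * Real.exp (κ * t) * (1 + y t / p) ^ p)))
    (v := fun t z => (z.2, -(lam * Real.exp (κ * t) * Real.exp z.1)))
    (s := fun _ => {z : ℝ × ℝ | z.1 ≤ 0}) (K := ⟨max 1 (lam * M), hK⟩)
    (a := 0) (b := b) (δ := 0) (εf := 0)
    (εg := M * (|Λ - lam| + lam * (2 * C ^ 2 / p))) ?_ ?_ ?_ ?_ ?_ ?_ ?_ ?_ ?_ ?_ t ht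
  · rw [zero_add, sub_zero, Prod.dist_eq, Real.dist_eq, Real.dist_eq] at key
    exact key.trans (gronwallBound_mono le_rfl hε hK ht.2)
  · intro x hx
    refine LipschitzOnWith.of_dist_le_mul ?_
    intro z hz w hw
    have hexp : |Real.exp z.1 - Real.exp w.1| ≤ |z.1 - w.1| := by
      have := Convex.norm_image_sub_le_of_norm_hasDerivWithin_le (f := Real.exp)
        (f' := Real.exp) (s := Iic 0) (C := 1) (x := w.1) (y := z.1)
        (fun x _ => (Real.hasDerivAt_exp x).hasDerivWithinAt)
        (fun x hx => by
          rw [Real.norm_of_nonneg (Real.exp_pos x).le]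
          exact Real.exp_le_one_iff.2 hx) (convex_Iic 0) hw hz
      simpa using this
    have hx' := hM x ⟨hx.1, hx.2.le⟩
    simp only [Prod.dist_eq, Real.dist_eq]
    have e1 : -(lam * Real.exp (κ * x) * Real.exp z.1) -
        -(lam * Real.exp (κ * x) * Real.exp w.1) =
        -(lam * Real.exp (κ * x) * (Real.exp z.1 - Real.exp w.1)) := by ring
    rw [e1, abs_neg, abs_mul, abs_of_nonneg (by positivity : 0 ≤ lam * Real.exp (κ * x))]
    refine max_le ?_ ?_
    · calc |z.2 - w.2| = 1 * |z.2 - w.2| := (one_mul _).symm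
        _ ≤ _ := by gcongr
                    · exact le_max_left _ _
                    · exact le_max_right _ _
    · calc lam * Real.exp (κ * x) * |Real.exp z.1 - Real.exp w.1|
          ≤ lam * M * |z.1 - w.1| := by gcongr
        _ ≤ _ := by gcongr
                    · exact le_max_right _ _
                    · exact le_max_left _ _
  · exact fun x hx => ((hY x hx).continuousAt.prodMk (hY' x hx).continuousAt).continuousWithinAt
  · exact fun x hx => ((hY x (Ico_subset_Icc_self hx)).prodMk
      (hY' x (Ico_subset_Icc_self hx))).hasDerivWithinAt
  · exact fun x hx => (dist_self _).le
  · exact fun x hx => hYneg x (Ico_subset_Icc_self hx)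
  · exact fun x hx => ((h.hasDeriv x (hIco x hx)).continuousAt.prodMk
      (h.hasDeriv' x (hIco x hx)).continuousAt).continuousWithinAt
  · exact fun x hx => ((h.hasDeriv x (hIco x (Ico_subset_Icc_self hx))).prodMk
      (h.hasDeriv' x (hIco x (Ico_subset_Icc_self hx)))).hasDerivWithinAt
  · intro x hx
    have hx1 := Ico_subset_Icc_self hx
    have hmem := h.mem x (Ico_subset_Icc_self (hIco x hx1))
    have h1 := rpow_one_add_div_mem hp hmem
    have h2 := rpow_one_add_div_le_exp hp hmem
    have h3 := exp_sub_le_rpow_one_add_div hp hC ⟨hyC x hx1, hmem.2⟩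
    have hx' := hM x hx1
    simp only [Prod.dist_eq, Real.dist_eq, sub_self, abs_zero]
    refine max_le hε ?_
    have e1 : -(Λ * Real.exp (κ * x) * (1 + y x / p) ^ p) -
        -(lam * Real.exp (κ * x) * Real.exp (y x)) =
        -(Real.exp (κ * x) * ((Λ - lam) * (1 + y x / p) ^ p +
          lam * ((1 + y x / p) ^ p - Real.exp (y x)))) := by ring
    rw [e1, abs_neg, abs_mul, abs_of_pos (Real.exp_pos _)]
    gcongr
    refine (abs_add_le _ _).trans ?_
    rw [abs_mul, abs_mul, abs_of_nonneg h1.1, abs_of_nonneg hlam]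
    have h4 : |(1 + y x / p) ^ p - Real.exp (y x)| ≤ 2 * C ^ 2 / p := by
      rw [abs_le]
      have : 0 ≤ 2 * C ^ 2 / p := by positivity
      constructor <;> linarith
    gcongr
    exact mul_le_of_le_one_right (abs_nonneg _) h1.2
  · exact fun x hx => (h.mem x (Ico_subset_Icc_self (hIco x (Ico_subset_Icc_self hx)))).2
  · simp [hY0, hY0', h.zero, h.zero']

/-- Half profiles exist on longer and longer intervals and converge to the solution of the
Liouville equation as the exponent diverges. -/
lemma eventually_halfProfile_close {pn Λn Rn : ℕ → ℝ} {κ lam : ℝ} {y y' : ℕ → ℝ → ℝ}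
    {Y Y' : ℝ → ℝ} (h : ∀ n, IsHalfProfile (pn n) (Λn n) κ (Rn n) (y n) (y' n))
    (hp : Tendsto pn atTop atTop) (hΛ0 : ∀ n, 0 ≤ Λn n) (hΛ : Tendsto Λn atTop (nhds lam))
    (hlam : 0 ≤ lam) (hY0 : Y 0 = 0) (hY0' : Y' 0 = 0) (hYneg : ∀ t, Y t ≤ 0)
    (hY : ∀ t, HasDerivAt Y (Y' t) t)
    (hY' : ∀ t, HasDerivAt Y' (-(lam * Real.exp (κ * t) * Real.exp (Y t))) t)
    {b δ : ℝ} (hb : 0 < b) (hδ : 0 < δ) :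
    ∀ᶠ n in atTop, b < Rn n ∧ ∀ t ∈ Icc 0 b, |Y t - y n t| < δ ∧ |Y' t - y' n t| < δ := by
  set M := Real.exp (|κ| * b) with hMdef
  set Q := lam + 1
  set C := Q * M * b ^ 2 / 2 with hCdef
  have hMpos : 0 < M := Real.exp_pos _
  have hQ : 0 < Q := by positivity
  have hCpos : 0 < C := by positivity
  have hM : ∀ t ∈ Icc 0 b, Real.exp (κ * t) ≤ M := by
    intro t ht
    refine Real.exp_le_exp.2 ?_
    calc κ * t ≤ |κ| * t := mul_le_mul_of_nonneg_right (le_abs_self κ) ht.1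
      _ ≤ |κ| * b := mul_le_mul_of_nonneg_left ht.2 (abs_nonneg κ)
  have hlim : Tendsto (fun n => gronwallBound 0 (max 1 (lam * M))
      (M * (|Λn n - lam| + lam * (2 * C ^ 2 / pn n))) b) atTop (nhds 0) := by
    have h1 : Tendsto (fun n => M * (|Λn n - lam| + lam * (2 * C ^ 2 / pn n))) atTop
        (nhds 0) := by
      have h2 : Tendsto (fun n => |Λn n - lam|) atTop (nhds 0) := by
        simpa using (hΛ.sub_const lam).abs
      have h3 : Tendsto (fun n => 2 * C ^ 2 / pn n) atTop (nhds 0) :=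
        tendsto_const_nhds.div_atTop hp
      simpa using (h2.add (h3.const_mul lam)).const_mul M
    have h4 := ((gronwallBound_continuous_ε 0 (max 1 (lam * M)) b).tendsto 0).comp h1
    rwa [gronwallBound_ε0_δ0] at h4
  filter_upwards [hlim.eventually_lt_const hδ, hΛ.eventually_lt_const (lt_add_one lam),
    hp.eventually_gt_atTop (2 * C)] with n hn1 hn2 hn3
  have hpn : 0 < pn n := by linarith
  have hM' : ∀ t ∈ Icc 0 b, Λn n * Real.exp (κ * t) ≤ Q * M := by
    intro t ht
    have := hM t ht
    gcongr
  have hbR : b < Rn n := by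
    by_contra! hR
    have h1 := (h n).lower_bound hpn (M := Q * M)
      (fun x hx => hM' x ⟨hx.1.le, hx.2.le.trans hR⟩) (hΛ0 n) (right_mem_Icc.2 (h n).R_pos.le)
    rw [(h n).last] at h1
    have h2 : Q * M * Rn n ^ 2 / 2 ≤ C := by
      have := (h n).R_pos.le
      rw [hCdef]
      gcongr
    linarith
  refine ⟨hbR, fun t ht => ?_⟩
  have hyC : ∀ t ∈ Icc 0 b, -C ≤ y n t := by
    intro t ht
    have h1 := (h n).lower_bound hpn (M := Q * M)
      (fun x hx => hM' x ⟨hx.1.le, hx.2.le.trans ht.2⟩) (hΛ0 n) ⟨ht.1, ht.2.trans hbR.le⟩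
    have h2 : Q * M * t ^ 2 / 2 ≤ C := by
      have := ht.1
      have := ht.2
      rw [hCdef]
      gcongr
    linarith
  have key := ((h n).abs_sub_le hpn hn3.le hbR hyC hlam hM hY0 hY0' (fun t _ => hYneg t)
    (fun t _ => hY t) (fun t _ => hY' t) t ht).trans_lt hn1
  exact max_lt_iff.1 key

/-- A function with nonnegative derivative on `(-∞, T)`, continuous on `(-∞, T]`, is at least its
limit at `-∞`. -/
lemma le_of_tendsto_atBot_of_hasDerivAt {f f' : ℝ → ℝ} {T c : ℝ}
    (hd : ∀ x ≤ T, HasDerivAt f (f' x) x) (h : ∀ x < T, 0 ≤ f' x)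
    (hc : Tendsto f atBot (nhds c)) {t : ℝ} (ht : t ≤ T) : c ≤ f t := by
  refine le_of_tendsto hc ?_
  filter_upwards [eventually_le_atBot t] with x hx
  exact le_of_hasDerivAt_nonneg hx
    (fun z hz => (hd z (hz.2.trans ht)).continuousAt.continuousWithinAt)
    (fun z hz => hd z (hz.2.le.trans ht)) (fun z hz => h z (hz.2.trans_le ht))

lemma tendsto_exp_two_mul_atBot : Tendsto (fun t : ℝ => Real.exp (2 * t)) atBot (nhds 0) :=
  Real.tendsto_exp_atBot.comp (tendsto_id.const_mul_atBot two_pos)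

lemma hasDerivAt_exp_two_mul (t : ℝ) :
    HasDerivAt (fun t : ℝ => Real.exp (2 * t)) (Real.exp (2 * t) * 2) t := by
  simpa using ((hasDerivAt_id t).const_mul (2 : ℝ)).exp

/-- Bounds, uniform in the exponent, for the position and the slope at the first zero of
`1 + y / p`, where `y'' + e^{2t} (1 + y / p) ^ p = 0` and `y, y' → 0` at `-∞`. -/
lemma inner_profile_bounds {p T : ℝ} {y y' : ℝ → ℝ} (hp : 1 ≤ p)
    (hd : ∀ t ≤ T, HasDerivAt y (y' t) t)
    (hd' : ∀ t ≤ T, HasDerivAt y' (-(Real.exp (2 * t) * (1 + y t / p) ^ p)) t)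
    (hm : ∀ t ≤ T, y t ∈ Icc (-p) 0) (hT : y T = -p)
    (h0 : Tendsto y atBot (nhds 0)) (h0' : Tendsto y' atBot (nhds 0)) :
    0 ≤ T ∧ T ≤ 8 / 3 * p ∧ 3 / 8 ≤ -y' T ∧ -y' T ≤ 4 := by
  have hp0 : 0 < p := by linarith
  have hE := tendsto_exp_two_mul_atBot
  have hy' : ∀ t ≤ T, 0 ≤ y' t + Real.exp (2 * t) / 2 := by
    intro t ht
    refine le_of_tendsto_atBot_of_hasDerivAt (T := T)
      (f := fun t => y' t + Real.exp (2 * t) / 2)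
      (fun x hx => (hd' x hx).add ((hasDerivAt_exp_two_mul x).div_const 2)) ?_ ?_ ht
    · intro x hx
      have h1 := rpow_one_add_div_mem hp0 (hm x hx.le)
      nlinarith [h1.2, Real.exp_pos (2 * x)]
    · simpa using h0'.add (hE.div_const 2)
  have hy : ∀ t ≤ T, 0 ≤ y t + Real.exp (2 * t) / 4 := by
    intro t ht
    refine le_of_tendsto_atBot_of_hasDerivAt (T := T)
      (f := fun t => y t + Real.exp (2 * t) / 4)
      (fun x hx => (hd x hx).add ((hasDerivAt_exp_two_mul x).div_const 4)) ?_ ?_ ht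
    · intro x hx
      linarith [hy' x hx.le]
    · simpa using h0.add (hE.div_const 4)
  have hT0 : 0 ≤ T := by
    by_contra! hneg
    have h1 := hy T le_rfl
    have h2 : Real.exp (2 * T) < 1 := by
      rw [← Real.exp_zero, Real.exp_lt_exp]; linarith
    linarith
  have hmid : 3 / 8 ≤ -y' 0 := by
    have key := le_of_tendsto_atBot_of_hasDerivAt (T := 0) (c := 0)
      (f := fun t => -y' t + -(3 / 8 * Real.exp (2 * t)))
      (fun x hx => (hd' x (hx.trans hT0)).neg.add
        (((hasDerivAt_exp_two_mul x).const_mul (3 / 8)).neg)) ?_ ?_ le_rfl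
    · simp only [mul_zero, Real.exp_zero] at key
      linarith
    · intro x hx
      have hxT := hx.le.trans hT0
      have h1 := hy x hxT
      have h2 : Real.exp (2 * x) ≤ 1 := Real.exp_le_one_iff.2 (by linarith)
      have h5 : -1 ≤ y x / p := by rw [le_div_iff₀ hp0]; linarith
      have := one_add_mul_self_le_rpow_one_add h5 hp
      rw [mul_div_cancel₀ _ hp0.ne'] at this
      nlinarith [Real.exp_pos (2 * x)]
    · simpa using h0'.neg.add ((hE.const_mul (3 / 8)).neg)
  have hanti : ∀ t ∈ Icc 0 T, 3 / 8 ≤ -y' t := by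
    intro t ht
    refine hmid.trans (le_of_hasDerivAt_nonneg (f := fun t => -y' t) ht.1
      (fun x hx => (hd' x (hx.2.trans ht.2)).neg.continuousAt.continuousWithinAt)
      (fun x hx => (hd' x (hx.2.le.trans ht.2)).neg) ?_)
    intro x hx
    have h1 := (rpow_one_add_div_mem hp0 (hm x (hx.2.le.trans ht.2))).1
    rw [neg_neg]; positivity
  refine ⟨hT0, ?_, hanti T ⟨hT0, le_rfl⟩, ?_⟩
  · have key := le_of_hasDerivAt_nonneg (f := fun t => -y t + -(3 / 8 * t))
      (f' := fun t => -y' t + -(3 / 8 * 1)) hT0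
      (fun x hx => ((hd x hx.2).continuousAt.neg.add (by fun_prop)).continuousWithinAt)
      (fun x hx => (hd x hx.2.le).neg.add (((hasDerivAt_id x).const_mul _).neg))
      (fun x hx => by linarith [hanti x ⟨hx.1.le, hx.2.le⟩])
    have := (hm 0 hT0).2
    simp only [hT] at key
    linarith
  · have hbase : ∀ t ≤ T, 0 ≤ 1 + y t / p := by
      intro t ht
      have : -1 ≤ y t / p := by rw [le_div_iff₀ hp0]; linarith [(hm t ht).1]
      linarith
    have key := le_of_tendsto_atBot_of_hasDerivAt (T := T) (c := 0)
      (f := fun t => -(y' t ^ 2 / 2 + 2 * y' t +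
        p / (p + 1) * (Real.exp (2 * t) * (1 + y t / p) ^ (p + 1))))
      (fun x hx => (((((hd' x hx).pow 2).div_const 2).add ((hd' x hx).const_mul 2)).add
        (((hasDerivAt_exp_two_mul x).mul
          ((((hd x hx).div_const p).const_add 1).rpow_const (p := p + 1)
            (Or.inr (by linarith)))).const_mul (p / (p + 1)))).neg) ?_ ?_ le_rfl
    · simp only [hT] at key
      rw [neg_div, div_self hp0.ne', add_neg_cancel, Real.zero_rpow (by linarith)] at key
      have := hanti T ⟨hT0, le_rfl⟩
      nlinarith
    · intro x hx
      have h1 := rpow_one_add_div_mem hp0 (hm x hx.le)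
      have h2 : (1 + y x / p) ^ (p + 1) = (1 + y x / p) ^ p * (1 + y x / p) :=
        Real.rpow_add_one' (hbase x hx.le) (by linarith)
      have h3 : 1 + y x / p ≤ 1 := by
        have := div_nonpos_of_nonpos_of_nonneg (hm x hx.le).2 hp0.le
        linarith
      rw [add_sub_cancel_right, h2]
      have h4 : p / (p + 1) * (Real.exp (2 * x) * 2 * ((1 + y x / p) ^ p * (1 + y x / p)) +
          Real.exp (2 * x) * (y' x / p * (p + 1) * (1 + y x / p) ^ p)) =
          2 * (p / (p + 1)) * (1 + y x / p) * (Real.exp (2 * x) * (1 + y x / p) ^ p) +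
          y' x * (Real.exp (2 * x) * (1 + y x / p) ^ p) := by
        field_simp
      have h5 : 0 ≤ Real.exp (2 * x) * (1 + y x / p) ^ p :=
        mul_nonneg (Real.exp_pos _).le h1.1
      have h6 : p / (p + 1) * (1 + y x / p) ≤ 1 :=
        mul_le_one₀ (by rw [div_le_one (by linarith)]; linarith) (hbase x hx.le) h3
      rw [h4]
      push_cast
      nlinarith
    · have h1 : Tendsto (fun t => (1 + y t / p) ^ (p + 1)) atBot (nhds 1) := by
        have := ((h0.div_const p).const_add 1).rpow_const (p := p + 1)
          (Or.inr (by linarith))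
        simpa using this
      have := (((h0'.pow 2).div_const 2).add (h0'.const_mul 2)).add
        ((hE.mul h1).const_mul (p / (p + 1)))
      simpa using this.neg

/-- The profile `u` in the variable `τ = log (r / c)`, rescaled around the value `N`. -/
def emdenProfile (u : ℝ → ℝ) (p c N : ℝ) (τ : ℝ) : ℝ :=
  p * (u (c * Real.exp τ) / N - 1)

/-- The derivative of `emdenProfile`. -/
def emdenSlope (u : ℝ → ℝ) (p c N : ℝ) (τ : ℝ) : ℝ :=
  p * (c * Real.exp τ * deriv u (c * Real.exp τ) / N)

namespace LaneEmdenFamily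

variable (F : LaneEmdenFamily) {p : ℝ}

lemma hasDerivAt_u (hp : 1 < p) {r : ℝ} (hr : r ∈ Ioo (0 : ℝ) 1) :
    HasDerivAt (F.u p) (deriv (F.u p) r) r ∧
      HasDerivAt (deriv (F.u p)) (deriv (deriv (F.u p)) r) r := by
  have h1 : ContDiffOn ℝ (1 + 1) (F.u p) (Ioo 0 1) :=
    ((F.smooth p hp).mono Ioo_subset_Icc_self).of_le (by norm_num)
  rw [contDiffOn_succ_iff_deriv_of_isOpen isOpen_Ioo] at h1
  have hn := isOpen_Ioo.mem_nhds hr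
  exact ⟨((h1.1 r hr).differentiableAt hn).hasDerivAt,
    (((h1.2.2.differentiableOn one_ne_zero) r hr).differentiableAt hn).hasDerivAt⟩

lemma hasDerivAt_emdenProfile (hp : 1 < p) {c N τ : ℝ} (hτ : c * Real.exp τ ∈ Ioo (0 : ℝ) 1) :
    HasDerivAt (emdenProfile (F.u p) p c N) (emdenSlope (F.u p) p c N τ) τ := by
  have h1 : HasDerivAt (fun τ => c * Real.exp τ) (c * Real.exp τ) τ :=
    (Real.hasDerivAt_exp τ).const_mul c
  have h2 := ((((F.hasDerivAt_u hp hτ).1.comp τ h1).div_const N).sub_const 1).const_mul p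
  refine h2.congr_deriv ?_
  rw [emdenSlope]
  ring

lemma one_add_emdenProfile_div (hp : 1 < p) (c N τ : ℝ) :
    1 + emdenProfile (F.u p) p c N τ / p = F.u p (c * Real.exp τ) / N := by
  rw [emdenProfile, mul_div_cancel_left₀ _ (by linarith)]
  ring

lemma hasDerivAt_emdenSlope (hp : 1 < p) {c N τ : ℝ} (hN : N ≠ 0)
    (hτ : c * Real.exp τ ∈ Ioo (0 : ℝ) 1) (hu : 0 ≤ F.u p (c * Real.exp τ) / N) :
    HasDerivAt (emdenSlope (F.u p) p c N) (-(p * c ^ 2 * |N| ^ (p - 1) * Real.exp (2 * τ) *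
      (1 + emdenProfile (F.u p) p c N τ / p) ^ p)) τ := by
  have h1 : HasDerivAt (fun τ => c * Real.exp τ) (c * Real.exp τ) τ :=
    (Real.hasDerivAt_exp τ).const_mul c
  have h2 := ((h1.mul ((F.hasDerivAt_u hp hτ).2.comp τ h1)).div_const N).const_mul p
  refine h2.congr_deriv ?_
  rw [F.one_add_emdenProfile_div hp]
  have hode := F.ode p hp _ hτ
  have he : Real.exp (2 * τ) = Real.exp τ ^ 2 := by
    rw [two_mul, Real.exp_add, sq]
  simp only [Function.comp_apply]
  set r := c * Real.exp τ with hr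
  have hr2 : c ^ 2 * Real.exp (2 * τ) = r ^ 2 := by rw [he, hr]; ring
  set h := F.u p r / N with hh
  have huN : F.u p r = N * h := by rw [hh]; field_simp
  have hr0 : r ≠ 0 := hτ.1.ne'
  have hpow : h ^ p = h ^ (p - 1) * h := by
    rw [← Real.rpow_add_one' hu (by linarith)]; ring_nf
  rw [huN, abs_mul, abs_of_nonneg hu, Real.mul_rpow (abs_nonneg _) hu] at hode
  have hkey : r * deriv (F.u p) r + r * (deriv (deriv (F.u p)) r * r) =
      -(r ^ 2 * (|N| ^ (p - 1) * h ^ (p - 1) * (N * h))) := by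
    rw [← hode]
    field_simp
    ring
  rw [hkey, hpow]
  calc p * (-(r ^ 2 * (|N| ^ (p - 1) * h ^ (p - 1) * (N * h))) / N)
      = -(p * r ^ 2 * |N| ^ (p - 1) * (h ^ (p - 1) * h)) := by field_simp
    _ = _ := by rw [← hr2]; ring

lemma sp_mem_Ioo (hp : 1 < p) : F.sp p ∈ Ioo (0 : ℝ) 1 :=
  ⟨(F.rp_mem p hp).1.trans (F.sp_mem p hp).1, (F.sp_mem p hp).2⟩

lemma u_sp_pos (hp : 1 < p) : 0 < F.u p (F.sp p) := F.pos_out p hp _ (F.sp_mem p hp)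

lemma deriv_u_sp (hp : 1 < p) : deriv (F.u p) (F.sp p) = 0 := by
  refine IsLocalMax.deriv_eq_zero ?_
  filter_upwards [isOpen_Ioo.mem_nhds (F.sp_mem_Ioo hp)] with r hr
  exact F.sp_max p hp r (Ioo_subset_Icc_self hr)

lemma epsP_pos (hp : 1 < p) : 0 < epsP F p := by
  have := Real.rpow_pos_of_pos (F.u_sp_pos hp) (p - 1)
  rw [epsP]
  positivity

lemma sq_sp_div_epsP (hp : 1 < p) :
    (F.sp p / epsP F p) ^ 2 = p * F.sp p ^ 2 * |F.u p (F.sp p)| ^ (p - 1) := by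
  have h1 := Real.rpow_pos_of_pos (F.u_sp_pos hp) (p - 1)
  have h2 : 0 ≤ p * F.u p (F.sp p) ^ (p - 1) := by positivity
  rw [epsP, abs_of_pos (F.u_sp_pos hp), div_div_eq_mul_div, div_one, mul_pow, Real.sq_sqrt h2]
  ring

lemma u_nonneg (hp : 1 < p) {r : ℝ} (hr : r ∈ Icc (F.rp p) 1) : 0 ≤ F.u p r := by
  rcases hr.1.eq_or_lt with h | h
  · rw [← h, F.rp_zero p hp]
  · rcases hr.2.eq_or_lt with h' | h'
    · rw [h', F.boundary p hp]
    · exact (F.pos_out p hp r ⟨h, h'⟩).le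

lemma emdenProfile_outer_mem (hp : 1 < p) {τ : ℝ}
    (hτ : F.sp p * Real.exp τ ∈ Icc (F.rp p) 1) :
    emdenProfile (F.u p) p (F.sp p) (F.u p (F.sp p)) τ ∈ Icc (-p) 0 := by
  have h1 := F.u_nonneg hp hτ
  have h2 := F.sp_max p hp _ ⟨(F.rp_mem p hp).1.le.trans hτ.1, hτ.2⟩
  have h3 : 0 ≤ F.u p (F.sp p * Real.exp τ) / F.u p (F.sp p) := div_nonneg h1 (F.u_sp_pos hp).le
  have h4 : F.u p (F.sp p * Real.exp τ) / F.u p (F.sp p) ≤ 1 := by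
    rw [div_le_one (F.u_sp_pos hp)]; exact h2
  rw [emdenProfile]
  constructor <;> nlinarith

lemma hasDerivAt_emdenSlope_outer (hp : 1 < p) {τ : ℝ}
    (hτ : F.sp p * Real.exp τ ∈ Ico (F.rp p) 1) :
    HasDerivAt (emdenSlope (F.u p) p (F.sp p) (F.u p (F.sp p)))
      (-((F.sp p / epsP F p) ^ 2 * Real.exp (2 * τ) *
      (1 + emdenProfile (F.u p) p (F.sp p) (F.u p (F.sp p)) τ / p) ^ p)) τ := by
  rw [F.sq_sp_div_epsP hp]
  exact F.hasDerivAt_emdenSlope hp (F.u_sp_pos hp).ne' ⟨(F.rp_mem p hp).1.trans_le hτ.1, hτ.2⟩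
    (div_nonneg (F.u_nonneg hp ⟨hτ.1, hτ.2.le⟩) (F.u_sp_pos hp).le)

lemma emdenProfile_outer_zero (hp : 1 < p) :
    emdenProfile (F.u p) p (F.sp p) (F.u p (F.sp p)) 0 = 0 := by
  simp [emdenProfile, (F.u_sp_pos hp).ne']

lemma emdenSlope_outer_zero (hp : 1 < p) :
    emdenSlope (F.u p) p (F.sp p) (F.u p (F.sp p)) 0 = 0 := by
  simp [emdenSlope, F.deriv_u_sp hp]

lemma isHalfProfile_forward (hp : 1 < p) :
    IsHalfProfile p ((F.sp p / epsP F p) ^ 2) 2 (-Real.log (F.sp p))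
      (emdenProfile (F.u p) p (F.sp p) (F.u p (F.sp p)))
      (emdenSlope (F.u p) p (F.sp p) (F.u p (F.sp p))) := by
  have hs := F.sp_mem_Ioo hp
  have hexp : ∀ t, 0 ≤ t → F.rp p < F.sp p * Real.exp t := by
    intro t ht
    have : 1 ≤ Real.exp t := Real.one_le_exp ht
    nlinarith [(F.sp_mem p hp).1, hs.1]
  have hlast : F.sp p * Real.exp (-Real.log (F.sp p)) = 1 := by
    rw [Real.exp_neg, Real.exp_log hs.1, mul_inv_cancel₀ hs.1.ne']
  have hlt : ∀ t, t < -Real.log (F.sp p) → F.sp p * Real.exp t < 1 := by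
    intro t ht
    rw [← hlast]
    exact mul_lt_mul_of_pos_left (Real.exp_lt_exp.2 ht) hs.1
  have hle : ∀ t, t ≤ -Real.log (F.sp p) → F.sp p * Real.exp t ≤ 1 := by
    intro t ht
    rw [← hlast]
    exact mul_le_mul_of_nonneg_left (Real.exp_le_exp.2 ht) hs.1.le
  exact
    { R_pos := neg_pos.2 (Real.log_neg hs.1 hs.2)
      cont := by
        have h1 : ContinuousOn (fun t => F.u p (F.sp p * Real.exp t))
            (Icc 0 (-Real.log (F.sp p))) :=
          (F.smooth p hp).continuousOn.comp (by fun_prop) (fun t ht =>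
            ⟨(F.rp_mem p hp).1.le.trans (hexp t ht.1).le, hle t ht.2⟩)
        exact ((h1.div_const _).sub continuousOn_const).const_mul p
      zero := F.emdenProfile_outer_zero hp
      zero' := F.emdenSlope_outer_zero hp
      last := by
        rw [emdenProfile, hlast, F.boundary p hp]
        ring
      mem := fun t ht => F.emdenProfile_outer_mem hp ⟨(hexp t ht.1).le, hle t ht.2⟩
      hasDeriv := fun t ht => F.hasDerivAt_emdenProfile hp
        ⟨(F.rp_mem p hp).1.trans (hexp t ht.1), hlt t ht.2⟩
      hasDeriv' := fun t ht => F.hasDerivAt_emdenSlope_outer hp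
        ⟨(hexp t ht.1).le, hlt t ht.2⟩ }

lemma isHalfProfile_backward (hp : 1 < p) :
    IsHalfProfile p ((F.sp p / epsP F p) ^ 2) (-2) (Real.log (F.sp p / F.rp p))
      (fun t => emdenProfile (F.u p) p (F.sp p) (F.u p (F.sp p)) (-t))
      (fun t => -emdenSlope (F.u p) p (F.sp p) (F.u p (F.sp p)) (-t)) ∧
    ContinuousOn (fun t => -emdenSlope (F.u p) p (F.sp p) (F.u p (F.sp p)) (-t))
      (Icc 0 (Real.log (F.sp p / F.rp p))) ∧
    F.sp p * Real.exp (-Real.log (F.sp p / F.rp p)) = F.rp p := by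
  have hs := F.sp_mem_Ioo hp
  have hr := F.rp_mem p hp
  have hlast : F.sp p * Real.exp (-Real.log (F.sp p / F.rp p)) = F.rp p := by
    rw [Real.exp_neg, Real.exp_log (div_pos hs.1 hr.1), inv_div, mul_div_cancel₀ _ hs.1.ne']
  have hmem : ∀ t ∈ Icc 0 (Real.log (F.sp p / F.rp p)),
      F.sp p * Real.exp (-t) ∈ Ico (F.rp p) 1 := by
    intro t ht
    constructor
    · rw [← hlast]
      exact mul_le_mul_of_nonneg_left (Real.exp_le_exp.2 (neg_le_neg ht.2)) hs.1.le
    · have : Real.exp (-t) ≤ 1 := Real.exp_le_one_iff.2 (by linarith [ht.1])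
      nlinarith [hs.1, hs.2]
  have hd : ∀ t ∈ Icc 0 (Real.log (F.sp p / F.rp p)),
      HasDerivAt (fun t => emdenProfile (F.u p) p (F.sp p) (F.u p (F.sp p)) (-t))
        (-emdenSlope (F.u p) p (F.sp p) (F.u p (F.sp p)) (-t)) t := by
    intro t ht
    have := (F.hasDerivAt_emdenProfile hp (N := F.u p (F.sp p))
      ⟨hr.1.trans_le (hmem t ht).1, (hmem t ht).2⟩).comp t (hasDerivAt_neg t)
    exact this.congr_deriv (by ring)
  have hd' : ∀ t ∈ Icc 0 (Real.log (F.sp p / F.rp p)),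
      HasDerivAt (fun t => -emdenSlope (F.u p) p (F.sp p) (F.u p (F.sp p)) (-t))
        (-((F.sp p / epsP F p) ^ 2 * Real.exp (-2 * t) *
          (1 + emdenProfile (F.u p) p (F.sp p) (F.u p (F.sp p)) (-t) / p) ^ p)) t := by
    intro t ht
    have := ((F.hasDerivAt_emdenSlope_outer hp (hmem t ht)).comp t (hasDerivAt_neg t)).neg
    refine this.congr_deriv ?_
    rw [mul_neg, ← neg_mul]
    ring_nf
  refine ⟨?_, fun t ht => (hd' t ht).continuousAt.continuousWithinAt, hlast⟩
  exact
    { R_pos := Real.log_pos ((one_lt_div hr.1).2 (F.sp_mem p hp).1)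
      cont := fun t ht => (hd t ht).continuousAt.continuousWithinAt
      zero := by simpa using F.emdenProfile_outer_zero hp
      zero' := by simpa using F.emdenSlope_outer_zero hp
      last := by
        simp only [emdenProfile, hlast, F.rp_zero p hp]
        ring
      mem := fun t ht => F.emdenProfile_outer_mem hp ⟨(hmem t ht).1, (hmem t ht).2.le⟩
      hasDeriv := fun t ht => hd t (Ico_subset_Icc_self ht)
      hasDeriv' := fun t ht => hd' t (Ico_subset_Icc_self ht) }

lemma epsM_pos (hp : 1 < p) : 0 < epsM F p := by
  have := Real.rpow_pos_of_pos (neg_pos.2 (F.center_neg p hp)) (p - 1)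
  rw [epsM]
  positivity

lemma mul_sq_epsM (hp : 1 < p) : p * epsM F p ^ 2 * |F.u p 0| ^ (p - 1) = 1 := by
  have h1 := Real.rpow_pos_of_pos (neg_pos.2 (F.center_neg p hp)) (p - 1)
  have h2 : 0 < p * (-F.u p 0) ^ (p - 1) := by positivity
  rw [epsM, abs_of_neg (F.center_neg p hp), div_pow, Real.sq_sqrt h2.le]
  field_simp

lemma inner_bounds (hp : 1 < p) :
    0 ≤ Real.log (F.rp p / epsM F p) ∧ Real.log (F.rp p / epsM F p) ≤ 8 / 3 * p ∧
      3 / 8 ≤ p * (F.rp p * deriv (F.u p) (F.rp p) / -F.u p 0) ∧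
      p * (F.rp p * deriv (F.u p) (F.rp p) / -F.u p 0) ≤ 4 := by
  have hc := F.epsM_pos hp
  have hr := F.rp_mem p hp
  have h0 := F.center_neg p hp
  set c := epsM F p with hcdef
  set T := Real.log (F.rp p / c) with hT
  have hlast : c * Real.exp T = F.rp p := by
    rw [hT, Real.exp_log (div_pos hr.1 hc), mul_div_cancel₀ _ hc.ne']
  have hmem : ∀ t ≤ T, c * Real.exp t ∈ Ioc 0 (F.rp p) := by
    intro t ht
    refine ⟨by positivity, ?_⟩
    rw [← hlast]
    exact mul_le_mul_of_nonneg_left (Real.exp_le_exp.2 ht) hc.le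
  have hIoo : ∀ t ≤ T, c * Real.exp t ∈ Ioo (0 : ℝ) 1 := fun t ht =>
    ⟨(hmem t ht).1, (hmem t ht).2.trans_lt hr.2⟩
  have hnonpos : ∀ t ≤ T, F.u p (c * Real.exp t) ≤ 0 := by
    intro t ht
    rcases (hmem t ht).2.eq_or_lt with h | h
    · rw [h, F.rp_zero p hp]
    · exact (F.neg_in p hp _ ⟨(hmem t ht).1.le, h⟩).le
  have hlim : Tendsto (fun t => c * Real.exp t) atBot (nhdsWithin 0 (Ioo 0 1)) := by
    refine tendsto_nhdsWithin_iff.2 ⟨by simpa using Real.tendsto_exp_atBot.const_mul c, ?_⟩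
    filter_upwards [eventually_le_atBot T] with t ht using hIoo t ht
  have h0mem : (0 : ℝ) ∈ Icc (0 : ℝ) 1 := by simp
  have hu : Tendsto (fun t => F.u p (c * Real.exp t)) atBot (nhds (F.u p 0)) :=
    (((F.smooth p hp).continuousOn 0 h0mem).mono_left
      (nhdsWithin_mono 0 Ioo_subset_Icc_self)).comp hlim
  have hdu : Tendsto (fun t => deriv (F.u p) (c * Real.exp t)) atBot
      (nhds (derivWithin (F.u p) (Icc 0 1) 0)) := by
    have h1 : ContinuousOn (derivWithin (F.u p) (Icc 0 1)) (Icc 0 1) :=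
      (F.smooth p hp).continuousOn_derivWithin (uniqueDiffOn_Icc zero_lt_one) (by norm_num)
    have h2 := ((h1 0 h0mem).mono_left (nhdsWithin_mono 0 Ioo_subset_Icc_self)).comp hlim
    refine h2.congr' ?_
    filter_upwards [eventually_le_atBot T] with t ht
    exact derivWithin_of_mem_nhds (Icc_mem_nhds (hIoo t ht).1 (hIoo t ht).2)
  have key := inner_profile_bounds (p := p) (T := T) (y := emdenProfile (F.u p) p c (F.u p 0))
    (y' := emdenSlope (F.u p) p c (F.u p 0)) hp.le
    (fun t ht => F.hasDerivAt_emdenProfile hp (hIoo t ht)) ?_ ?_ ?_ ?_ ?_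
  · have h1 : -emdenSlope (F.u p) p c (F.u p 0) T =
        p * (F.rp p * deriv (F.u p) (F.rp p) / -F.u p 0) := by
      rw [emdenSlope, hlast, div_neg]
      ring
    rwa [h1] at key
  · intro t ht
    have := F.hasDerivAt_emdenSlope hp h0.ne (hIoo t ht)
      (div_nonneg_of_nonpos (hnonpos t ht) h0.le)
    rwa [F.mul_sq_epsM hp, one_mul] at this
  · intro t ht
    have h3 : 0 ≤ F.u p (c * Real.exp t) / F.u p 0 := div_nonneg_of_nonpos (hnonpos t ht) h0.le
    have h4 : F.u p (c * Real.exp t) / F.u p 0 ≤ 1 := by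
      rw [div_le_one_of_neg h0]
      exact F.min_at_zero p hp _ (Ioo_subset_Icc_self (hIoo t ht))
    rw [emdenProfile]
    constructor <;> nlinarith
  · rw [emdenProfile, hlast, F.rp_zero p hp]
    ring
  · have := ((hu.div_const (F.u p 0)).sub_const 1).const_mul p
    rwa [div_self h0.ne, sub_self, mul_zero] at this
  · have := (((hlim.mono_right nhdsWithin_le_nhds).mul hdu).div_const (F.u p 0)).const_mul p
    rwa [zero_mul, zero_div, mul_zero] at this

/-- The ratio `s_p / ε_p⁺` is bounded above and away from zero uniformly in `p`. -/
lemma sp_div_epsP_bounds (hp : 1 < p) :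
    3 / 4 ≤ (F.sp p / epsP F p) ^ 2 ∧
      F.sp p / epsP F p ≤ Real.exp (12 * Real.exp 2 + 8) := by
  obtain ⟨hT0, hT1, hc0, hc1⟩ := F.inner_bounds hp
  obtain ⟨hb, hbc, hlast⟩ := F.isHalfProfile_backward hp
  have hs := F.sp_mem_Ioo hp
  have hr := F.rp_mem p hp
  have hP := F.u_sp_pos hp
  have hN : 0 < -F.u p 0 := neg_pos.2 (F.center_neg p hp)
  have hc := F.epsM_pos hp
  have hLpos : 0 < F.sp p / epsP F p := div_pos hs.1 (F.epsP_pos hp)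
  have hsq := F.sq_sp_div_epsP hp
  have hM := F.mul_sq_epsM hp
  rw [abs_of_pos hP] at hsq
  rw [abs_of_neg (F.center_neg p hp)] at hM
  have hslope : -(-emdenSlope (F.u p) p (F.sp p) (F.u p (F.sp p))
      (-Real.log (F.sp p / F.rp p))) =
      p * (F.rp p * deriv (F.u p) (F.rp p) / F.u p (F.sp p)) := by
    rw [neg_neg, emdenSlope, hlast]
  have hup := hb.neg_deriv_le (by linarith) (sq_nonneg _) hbc
  have hlow := fun h => hb.le_neg_deriv hp.le h hbc
  have hRpos := hb.R_pos
  simp only [hslope] at hup hlow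
  set L := F.sp p / epsP F p with hL
  set R := Real.log (F.sp p / F.rp p) with hR
  set T := Real.log (F.rp p / epsM F p) with hT
  set P := F.u p (F.sp p) with hPdef
  set N := -F.u p 0 with hNdef
  set cm := p * (F.rp p * deriv (F.u p) (F.rp p) / N) with hcm
  set cp := p * (F.rp p * deriv (F.u p) (F.rp p) / P) with hcp
  have hx : cp * (P / N) = cm := by rw [hcm, hcp]; field_simp
  have hxpos : 0 < P / N := div_pos hP hN
  have hRT : Real.log (F.sp p / epsM F p) = R + T := by
    rw [hR, hT, ← Real.log_mul (div_pos hs.1 hr.1).ne' (div_pos hr.1 hc).ne',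
      div_mul_div_cancel₀ hr.1.ne']
  have hlog : 2 * Real.log L = 2 * (R + T) + (p - 1) * Real.log (P / N) := by
    have h1 : L ^ 2 = (F.sp p / epsM F p) ^ 2 * (P / N) ^ (p - 1) := by
      have h3 := Real.rpow_pos_of_pos hN (p - 1)
      rw [hsq, Real.div_rpow hP.le hN.le]
      field_simp
      rw [show p * F.sp p ^ 2 * epsM F p ^ 2 * N ^ (p - 1) =
        F.sp p ^ 2 * (p * epsM F p ^ 2 * N ^ (p - 1)) by ring, hM, mul_one]
    have h2 := congrArg Real.log h1
    rw [Real.log_mul (pow_pos (div_pos hs.1 hc) 2).ne' (Real.rpow_pos_of_pos hxpos _).ne',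
      Real.log_pow, Real.log_pow, Real.log_rpow hxpos, hRT] at h2
    exact_mod_cast h2
  constructor
  · by_contra! hlt
    have h1 : 1 ≤ P / N := by
      by_contra! h2
      nlinarith
    have h2 := Real.log_nonneg h1
    have h3 : 0 < Real.log L := by nlinarith
    have h4 := (Real.log_pos_iff hLpos.le).1 h3
    nlinarith
  · rcases le_or_gt L 1 with h1 | h1
    · exact h1.trans (Real.one_le_exp (by positivity))
    · obtain ⟨h2, h3⟩ := hlow h1.le
      have hE : Real.exp 2 * Real.exp (-2) = 1 := by rw [← Real.exp_add]; simp
      have h4 : L * (P / N) ≤ 8 * Real.exp 2 := by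
        have h5 : Real.exp (-2) * L / 2 * (P / N) ≤ 4 :=
          (mul_le_mul_of_nonneg_right h2 hxpos.le).trans (hx.trans_le hc1)
        have h6 := mul_le_mul_of_nonneg_left h5 (by positivity : 0 ≤ 2 * Real.exp 2)
        calc L * (P / N) = Real.exp 2 * Real.exp (-2) * (L * (P / N)) := by rw [hE, one_mul]
          _ = 2 * Real.exp 2 * (Real.exp (-2) * L / 2 * (P / N)) := by ring
          _ ≤ _ := by linarith
      have h5 : Real.log L + Real.log (P / N) ≤ 8 * Real.exp 2 := by
        rw [← Real.log_mul hLpos.ne' hxpos.ne']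
        exact (Real.log_le_self (by positivity)).trans h4
      have h6 : 0 < Real.log L := Real.log_pos h1
      have he : 0 < Real.exp 2 := Real.exp_pos 2
      rw [← Real.log_le_iff_le_exp hLpos]
      by_contra! h7
      nlinarith [mul_le_mul_of_nonneg_left h5 (by linarith : 0 ≤ p - 1),
        mul_lt_mul_of_pos_left h7 (by linarith : 0 < p + 1)]

end LaneEmdenFamily

lemma sq_alphaOf (l : ℝ) : alphaOf l ^ 2 = 2 * l ^ 2 + 4 := Real.sq_sqrt (by positivity)

lemma two_lt_alphaOf {l : ℝ} (hl : 0 < l) : 2 < alphaOf l :=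
  Real.lt_sqrt_of_sq_lt (by nlinarith)

/-- The ratio `(α - 2) / (α + 2)`. -/
def alphaRatio (l : ℝ) : ℝ := (alphaOf l - 2) / (alphaOf l + 2)

lemma alphaRatio_pos {l : ℝ} (hl : 0 < l) : 0 < alphaRatio l := by
  have := two_lt_alphaOf hl
  exact div_pos (by linarith) (by linarith)

/-- The function `τ ↦ Z_l (l e^τ)`. -/
def limitProfile (l τ : ℝ) : ℝ :=
  Real.log (2 * alphaOf l ^ 2 * alphaRatio l / l ^ 2) + (alphaOf l - 2) * τ
    - 2 * Real.log (1 + alphaRatio l * Real.exp (alphaOf l * τ))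

/-- The derivative of `limitProfile`. -/
def limitSlope (l τ : ℝ) : ℝ :=
  (alphaOf l - 2) - 2 * (alphaRatio l * (Real.exp (alphaOf l * τ) * alphaOf l) /
    (1 + alphaRatio l * Real.exp (alphaOf l * τ)))

lemma hasDerivAt_one_add_exp (l τ : ℝ) :
    HasDerivAt (fun τ => 1 + alphaRatio l * Real.exp (alphaOf l * τ))
      (alphaRatio l * (Real.exp (alphaOf l * τ) * alphaOf l)) τ := by
  simpa using (((hasDerivAt_id τ).const_mul (alphaOf l)).exp.const_mul (alphaRatio l)).const_add 1

lemma hasDerivAt_limitProfile {l : ℝ} (hl : 0 < l) (τ : ℝ) :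
    HasDerivAt (limitProfile l) (limitSlope l τ) τ := by
  have hk := alphaRatio_pos hl
  have h1 : 1 + alphaRatio l * Real.exp (alphaOf l * τ) ≠ 0 := by positivity
  have := (((hasDerivAt_id τ).const_mul (alphaOf l - 2)).const_add
    (Real.log (2 * alphaOf l ^ 2 * alphaRatio l / l ^ 2))).sub
    (((hasDerivAt_one_add_exp l τ).log h1).const_mul 2)
  exact this.congr_deriv (by rw [limitSlope, mul_one])

lemma exp_limitProfile {l : ℝ} (hl : 0 < l) (τ : ℝ) :
    Real.exp (limitProfile l τ) = 2 * alphaOf l ^ 2 * alphaRatio l / l ^ 2 *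
      Real.exp ((alphaOf l - 2) * τ) / (1 + alphaRatio l * Real.exp (alphaOf l * τ)) ^ 2 := by
  have hk := alphaRatio_pos hl
  have hα := two_lt_alphaOf hl
  have h1 : 0 < 1 + alphaRatio l * Real.exp (alphaOf l * τ) := by positivity
  have h2 : 0 < 2 * alphaOf l ^ 2 * alphaRatio l / l ^ 2 := by positivity
  rw [limitProfile, Real.exp_sub, Real.exp_add, Real.exp_log h2, two_mul (Real.log _),
    Real.exp_add, Real.exp_log h1, sq (1 + _)]

lemma hasDerivAt_limitSlope {l : ℝ} (hl : 0 < l) (τ : ℝ) :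
    HasDerivAt (limitSlope l)
      (-(l ^ 2 * Real.exp (2 * τ) * Real.exp (limitProfile l τ))) τ := by
  have hk := alphaRatio_pos hl
  have h1 : 0 < 1 + alphaRatio l * Real.exp (alphaOf l * τ) := by positivity
  have he : HasDerivAt (fun τ => alphaRatio l * (Real.exp (alphaOf l * τ) * alphaOf l))
      (alphaRatio l * (Real.exp (alphaOf l * τ) * (alphaOf l * 1) * alphaOf l)) τ :=
    ((((hasDerivAt_id τ).const_mul (alphaOf l)).exp).mul_const (alphaOf l)).const_mul _
  have := (((he.div (hasDerivAt_one_add_exp l τ) h1.ne').const_mul 2).const_sub (alphaOf l - 2))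
  refine this.congr_deriv ?_
  have h2 : Real.exp (alphaOf l * τ) = Real.exp (2 * τ) * Real.exp ((alphaOf l - 2) * τ) := by
    rw [← Real.exp_add]; ring_nf
  rw [exp_limitProfile hl]
  have h3 : l ^ 2 * Real.exp (2 * τ) * (2 * alphaOf l ^ 2 * alphaRatio l / l ^ 2 *
      Real.exp ((alphaOf l - 2) * τ) / (1 + alphaRatio l * Real.exp (alphaOf l * τ)) ^ 2) =
      2 * alphaOf l ^ 2 * alphaRatio l * Real.exp (alphaOf l * τ) /
        (1 + alphaRatio l * Real.exp (alphaOf l * τ)) ^ 2 := by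
    rw [h2]; field_simp
  rw [h3]
  field_simp
  ring

lemma limitProfile_zero {l : ℝ} (hl : 0 < l) : limitProfile l 0 = 0 := by
  have hα := two_lt_alphaOf hl
  have h1 : Real.exp (limitProfile l 0) = 1 := by
    have h2 : alphaOf l + 2 ≠ 0 := by linarith
    have h3 : alphaOf l ≠ 0 := by linarith
    have h4 : 1 + alphaRatio l = 2 * alphaOf l / (alphaOf l + 2) := by
      rw [alphaRatio]; field_simp; ring
    have h5 : l ^ 2 = (alphaOf l - 2) * (alphaOf l + 2) / 2 := by
      have := sq_alphaOf l
      linarith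
    rw [exp_limitProfile hl, mul_zero, mul_zero, Real.exp_zero, mul_one, mul_one, h4, h5,
      alphaRatio]
    have h6 : alphaOf l - 2 ≠ 0 := by linarith
    field_simp
  exact Real.exp_eq_one_iff _ |>.1 h1

lemma limitSlope_zero {l : ℝ} (hl : 0 < l) : limitSlope l 0 = 0 := by
  have hα := two_lt_alphaOf hl
  have h2 : alphaOf l + 2 ≠ 0 := by linarith
  have h3 : alphaOf l ≠ 0 := by linarith
  have h4 : 1 + alphaRatio l = 2 * alphaOf l / (alphaOf l + 2) := by
    rw [alphaRatio]; field_simp; ring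
  rw [limitSlope, mul_zero, Real.exp_zero, mul_one, one_mul, h4, alphaRatio]
  field_simp
  ring

lemma limitProfile_nonpos {l : ℝ} (hl : 0 < l) (τ : ℝ) : limitProfile l τ ≤ 0 := by
  have hanti : Antitone (limitSlope l) := by
    refine antitone_of_deriv_nonpos (fun t => (hasDerivAt_limitSlope hl t).differentiableAt) ?_
    intro t
    rw [(hasDerivAt_limitSlope hl t).deriv, neg_nonpos]
    positivity
  have hc : Continuous (limitProfile l) :=
    continuous_iff_continuousAt.2 fun t => (hasDerivAt_limitProfile hl t).continuousAt
  rcases le_total 0 τ with h | h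
  · have := le_of_hasDerivAt_nonneg (f := fun t => -limitProfile l t) h hc.neg.continuousOn
      (fun t _ => (hasDerivAt_limitProfile hl t).neg) (fun t ht => by
        have := hanti ht.1.le
        rw [limitSlope_zero hl] at this
        linarith)
    rw [limitProfile_zero hl] at this
    linarith
  · have := le_of_hasDerivAt_nonneg (f := limitProfile l) h hc.continuousOn
      (fun t _ => hasDerivAt_limitProfile hl t) (fun t ht => by
        have := hanti ht.2.le
        rwa [limitSlope_zero hl] at this)
    rwa [limitProfile_zero hl] at this

lemma Zl_mul_exp {l : ℝ} (hl : 0 < l) (τ : ℝ) : Zl l (l * Real.exp τ) = limitProfile l τ := by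
  have hk := alphaRatio_pos hl
  have hα := two_lt_alphaOf hl
  have hα0 : alphaOf l ≠ 0 := by linarith
  have hinv : (alphaOf l + 2) / (alphaOf l - 2) = (alphaRatio l)⁻¹ := by
    rw [alphaRatio, inv_div]
  have hla : 0 < l ^ alphaOf l := Real.rpow_pos_of_pos hl _
  have hβ : betaOf l ^ alphaOf l = (alphaRatio l)⁻¹ * l ^ alphaOf l := by
    rw [betaOf, hinv, Real.mul_rpow (by positivity) hl.le, ← Real.rpow_mul (by positivity),
      one_div_mul_cancel hα0, Real.rpow_one]
  have hr : (l * Real.exp τ) ^ alphaOf l = l ^ alphaOf l * Real.exp (alphaOf l * τ) := by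
    rw [Real.mul_rpow hl.le (Real.exp_pos _).le, ← Real.exp_mul, mul_comm τ]
  have hr2 : (l * Real.exp τ) ^ (alphaOf l - 2) =
      l ^ alphaOf l / l ^ 2 * Real.exp ((alphaOf l - 2) * τ) := by
    rw [Real.mul_rpow hl.le (Real.exp_pos _).le, ← Real.exp_mul, mul_comm τ,
      Real.rpow_sub hl, Real.rpow_two]
  rw [Zl, hβ, hr, hr2, ← Real.log_exp (limitProfile l τ), exp_limitProfile hl]
  congr 1
  have h1 : 0 < 1 + alphaRatio l * Real.exp (alphaOf l * τ) := by positivity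
  have h2 : (alphaRatio l)⁻¹ * l ^ alphaOf l + l ^ alphaOf l * Real.exp (alphaOf l * τ) =
      (alphaRatio l)⁻¹ * l ^ alphaOf l * (1 + alphaRatio l * Real.exp (alphaOf l * τ)) := by
    field_simp
  rw [h2]
  field_simp

lemma tendstoUniformlyOn_of_tendsto_prod {f : ℕ → ℝ → ℝ} {g : ℝ → ℝ} {K : Set ℝ}
    (hK : IsCompact K) (hg : ∀ x ∈ K, ContinuousAt g x)
    (h : ∀ x ∈ K, Tendsto (fun q : ℕ × ℝ => f q.1 q.2) (atTop ×ˢ nhds x) (nhds (g x))) :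
    TendstoUniformlyOn f g atTop K := by
  rw [← tendstoLocallyUniformlyOn_iff_tendstoUniformlyOn_of_compact hK,
    tendstoLocallyUniformlyOn_iff_forall_tendsto]
  intro x hx
  have h1 : Tendsto (fun q : ℕ × ℝ => g q.2) (atTop ×ˢ nhds x) (nhds (g x)) :=
    (hg x hx).tendsto.comp tendsto_snd
  exact ((h1.prodMk_nhds (h x hx)).mono_right (nhds_le_uniformity _)).mono_left
    (Filter.prod_mono le_rfl nhdsWithin_le_nhds)

namespace LaneEmdenFamily

variable (F : LaneEmdenFamily)

lemma eventually_outer_close {pn : ℕ → ℝ} {l : ℝ} (hpn : ∀ n, 1 < pn n)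
    (hto : Tendsto pn atTop atTop) (hl : 0 < l)
    (hlim : Tendsto (fun n => F.sp (pn n) / epsP F (pn n)) atTop (nhds l))
    {b δ : ℝ} (hb : 0 < b) (hδ : 0 < δ) :
    ∀ᶠ n in atTop, b < -Real.log (F.sp (pn n)) ∧ b < Real.log (F.sp (pn n) / F.rp (pn n)) ∧
      ∀ t ∈ Icc (-b) b,
        |limitProfile l t -
          emdenProfile (F.u (pn n)) (pn n) (F.sp (pn n)) (F.u (pn n) (F.sp (pn n))) t| < δ ∧
        |limitSlope l t -
          emdenSlope (F.u (pn n)) (pn n) (F.sp (pn n)) (F.u (pn n) (F.sp (pn n))) t| < δ := by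
  filter_upwards [eventually_halfProfile_close
      (fun n => F.isHalfProfile_forward (hpn n)) hto (fun _ => sq_nonneg _) (hlim.pow 2)
      (sq_nonneg l) (limitProfile_zero hl) (limitSlope_zero hl) (limitProfile_nonpos hl)
      (hasDerivAt_limitProfile hl) (hasDerivAt_limitSlope hl) hb hδ,
    eventually_halfProfile_close (Y := fun t => limitProfile l (-t))
      (Y' := fun t => -limitSlope l (-t))
      (fun n => (F.isHalfProfile_backward (hpn n)).1) hto (fun _ => sq_nonneg _) (hlim.pow 2)
      (sq_nonneg l) (by simpa using limitProfile_zero hl) (by simpa using limitSlope_zero hl)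
      (fun t => limitProfile_nonpos hl (-t))
      (fun t => ((hasDerivAt_limitProfile hl (-t)).comp t (hasDerivAt_neg t)).congr_deriv
        (by ring))
      (fun t => ((hasDerivAt_limitSlope hl (-t)).comp t (hasDerivAt_neg t)).neg.congr_deriv
        (by rw [mul_neg 2 t, ← neg_mul]; ring_nf)) hb hδ] with n h1 h2
  refine ⟨h1.1, h2.1, fun t ht => ?_⟩
  rcases le_total 0 t with h | h
  · exact h1.2 t ⟨h, ht.2⟩
  · have := h2.2 (-t) ⟨neg_nonneg.2 h, neg_le.1 ht.1⟩
    rw [neg_neg, neg_sub_neg, abs_sub_comm (emdenSlope _ _ _ _ _)] at this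
    exact this

lemma zPlus_eq_emdenProfile {p L r : ℝ} (hp : 1 < p) (hL : L = F.sp p / epsP F p)
    (hr : 0 < L + r) :
    F.sp p * Real.exp (Real.log ((L + r) / L)) = F.sp p + epsP F p * r ∧
    zPlus F p r =
      emdenProfile (F.u p) p (F.sp p) (F.u p (F.sp p)) (Real.log ((L + r) / L)) := by
  have hs := (F.sp_mem_Ioo hp).1
  have he := F.epsP_pos hp
  have hL0 : 0 < L := hL ▸ div_pos hs he
  have h1 : F.sp p * Real.exp (Real.log ((L + r) / L)) = F.sp p + epsP F p * r := by
    rw [Real.exp_log (div_pos hr hL0), hL]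
    field_simp
  refine ⟨h1, ?_⟩
  have := (F.u_sp_pos hp).ne'
  rw [zPlus, emdenProfile, h1]
  field_simp

lemma deriv_zPlus {p L r : ℝ} (hp : 1 < p) (hL : L = F.sp p / epsP F p) (hr : 0 < L + r)
    (hr1 : Real.log ((L + r) / L) < -Real.log (F.sp p)) :
    deriv (zPlus F p) r =
      emdenSlope (F.u p) p (F.sp p) (F.u p (F.sp p)) (Real.log ((L + r) / L)) / (L + r) := by
  have hs := (F.sp_mem_Ioo hp).1
  have hL0 : 0 < L := hL ▸ div_pos hs (F.epsP_pos hp)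
  have hmem : F.sp p * Real.exp (Real.log ((L + r) / L)) ∈ Ioo (0 : ℝ) 1 := by
    refine ⟨by positivity, ?_⟩
    have := Real.exp_lt_exp.2 hr1
    rw [Real.exp_neg, Real.exp_log hs, ← one_div, lt_div_iff₀ hs] at this
    linarith
  have hlog : HasDerivAt (fun r => Real.log ((L + r) / L)) (1 / (L + r)) r := by
    have := (((hasDerivAt_id r).const_add L).div_const L).log (div_pos hr hL0).ne'
    refine this.congr_deriv ?_
    simp only [id]
    field_simp
  have hd := (F.hasDerivAt_emdenProfile hp (N := F.u p (F.sp p)) hmem).comp r hlog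
  have heq : zPlus F p =ᶠ[nhds r] (emdenProfile (F.u p) p (F.sp p) (F.u p (F.sp p)) ∘
      fun r => Real.log ((L + r) / L)) := by
    have : ∀ᶠ r' in nhds r, 0 < L + r' :=
      (continuousAt_const.add continuousAt_id).eventually (lt_mem_nhds hr)
    filter_upwards [this] with r' hr'
    exact (F.zPlus_eq_emdenProfile hp hL hr').2
  rw [(hd.congr_of_eventuallyEq heq).deriv]
  ring

lemma exists_pos_limit {pn : ℕ → ℝ} (hpn : ∀ n, 1 < pn n)
    (hlim : Tendsto (fun n => F.sp (pn n) / epsP F (pn n)) atTop atTop ∨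
      ∃ l : ℝ, 0 ≤ l ∧ Tendsto (fun n => F.sp (pn n) / epsP F (pn n)) atTop (nhds l)) :
    ∃ l : ℝ, 0 < l ∧ Tendsto (fun n => F.sp (pn n) / epsP F (pn n)) atTop (nhds l) := by
  rcases hlim with h | ⟨l, hl, h⟩
  · obtain ⟨n, hn⟩ := (h.eventually_gt_atTop (Real.exp (12 * Real.exp 2 + 8))).exists
    exact absurd (F.sp_div_epsP_bounds (hpn n)).2 (not_le.2 hn)
  · refine ⟨l, hl.lt_of_ne' ?_, h⟩
    rintro rfl
    have := ge_of_tendsto' (h.pow 2) (fun n => (F.sp_div_epsP_bounds (hpn n)).1)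
    norm_num at this

end LaneEmdenFamily

/-- If along a sequence `p_n → +∞` the limit `l = lim s_{p_n}/ε_{p_n}⁺`
exists in `[0,+∞]`, then `0 < l < +∞`, `(r_{p_n} − s_{p_n})/ε_{p_n}⁺ → −l`, and the
rescalings `z_{p_n}⁺` converge in `C¹_loc((−l,+∞))` to `z̃_l(r) = Z_l(r + l)`. -/
theorem zPlus_tendsto_singular_liouville (F : LaneEmdenFamily) (pn : ℕ → ℝ)
    (hpn : ∀ n, 1 < pn n) (hto : Tendsto pn atTop atTop)
    (hlim : Tendsto (fun n => F.sp (pn n) / epsP F (pn n)) atTop atTop ∨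
      ∃ l : ℝ, 0 ≤ l ∧ Tendsto (fun n => F.sp (pn n) / epsP F (pn n)) atTop (nhds l)) :
    ∃ l : ℝ, 0 < l ∧
      Tendsto (fun n => F.sp (pn n) / epsP F (pn n)) atTop (nhds l) ∧
      Tendsto (fun n => (F.rp (pn n) - F.sp (pn n)) / epsP F (pn n)) atTop (nhds (-l)) ∧
      ∀ K : Set ℝ, IsCompact K → K ⊆ Ioi (-l) →
        TendstoUniformlyOn (fun n r => zPlus F (pn n) r)
          (fun r => Zl l (r + l)) atTop K ∧
        TendstoUniformlyOn (fun n r => deriv (zPlus F (pn n)) r)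
          (deriv fun r => Zl l (r + l)) atTop K := by
  obtain ⟨l, hl, hL⟩ := F.exists_pos_limit hpn hlim
  refine ⟨l, hl, hL, ?_, ?_⟩
  · have hratio : Tendsto (fun n => F.rp (pn n) / F.sp (pn n)) atTop (nhds 0) := by
      have h1 : Tendsto (fun n => Real.log (F.sp (pn n) / F.rp (pn n))) atTop atTop := by
        refine tendsto_atTop.2 fun b => ?_
        filter_upwards [F.eventually_outer_close hpn hto hl hL
          (lt_max_of_lt_right zero_lt_one : 0 < max b 1) one_pos] with n hn
        exact (le_max_left b 1).trans hn.2.1.le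
      refine (Real.tendsto_exp_neg_atTop_nhds_zero.comp h1).congr fun n => ?_
      have hs := (F.sp_mem_Ioo (hpn n)).1
      have hr := (F.rp_mem _ (hpn n)).1
      rw [Function.comp_apply, Real.exp_neg, Real.exp_log (div_pos hs hr), inv_div]
    have h2 := hL.mul (hratio.sub_const 1)
    rw [zero_sub, mul_neg_one] at h2
    refine h2.congr fun n => ?_
    have hs := (F.sp_mem_Ioo (hpn n)).1.ne'
    field_simp
  · intro K hK hKl
    have hpos : ∀ x ∈ K, 0 < l + x := fun x hx => by
      have := hKl hx
      rw [mem_Ioi] at this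
      linarith
    have hcont : Continuous (limitProfile l) :=
      continuous_iff_continuousAt.2 fun t => (hasDerivAt_limitProfile hl t).continuousAt
    have hcont' : Continuous (limitSlope l) :=
      continuous_iff_continuousAt.2 fun t => (hasDerivAt_limitSlope hl t).continuousAt
    have hlogd : ∀ x, 0 < l + x →
        HasDerivAt (fun r => Real.log ((l + r) / l)) (1 / (l + x)) x := by
      intro x hx
      have := (((hasDerivAt_id x).const_add l).div_const l).log (div_pos hx hl).ne'
      refine this.congr_deriv ?_
      simp only [id]
      field_simp
    have hZ : ∀ x, 0 < l + x → Zl l (x + l) = limitProfile l (Real.log ((l + x) / l)) := by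
      intro x hx
      rw [← Zl_mul_exp hl, Real.exp_log (div_pos hx hl), mul_div_cancel₀ _ hl.ne', add_comm]
    have hZev : ∀ x, 0 < l + x → (fun r => Zl l (r + l)) =ᶠ[nhds x]
        (limitProfile l ∘ fun r => Real.log ((l + r) / l)) := by
      intro x hx
      have : ∀ᶠ r in nhds x, 0 < l + r :=
        (continuousAt_const.add continuousAt_id).eventually (lt_mem_nhds hx)
      filter_upwards [this] with r hr using hZ r hr
    have hZd : ∀ x, 0 < l + x → deriv (fun r => Zl l (r + l)) x =
        limitSlope l (Real.log ((l + x) / l)) / (l + x) := by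
      intro x hx
      rw [(((hasDerivAt_limitProfile hl _).comp x (hlogd x hx)).congr_of_eventuallyEq
        (hZev x hx)).deriv]
      ring
    have hL1 : ∀ x : ℝ, Tendsto (fun q : ℕ × ℝ => F.sp (pn q.1) / epsP F (pn q.1))
        (atTop ×ˢ nhds x) (nhds l) := fun x => hL.comp tendsto_fst
    have hsum : ∀ x : ℝ, Tendsto (fun q : ℕ × ℝ => F.sp (pn q.1) / epsP F (pn q.1) + q.2)
        (atTop ×ˢ nhds x) (nhds (l + x)) := fun x => (hL1 x).add tendsto_snd
    have hτ : ∀ x, 0 < l + x → Tendsto (fun q : ℕ × ℝ =>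
        Real.log ((F.sp (pn q.1) / epsP F (pn q.1) + q.2) / (F.sp (pn q.1) / epsP F (pn q.1))))
        (atTop ×ˢ nhds x) (nhds (Real.log ((l + x) / l))) := fun x hx =>
      ((hsum x).div (hL1 x) hl.ne').log (div_pos hx hl).ne'
    have hclose : ∀ x, 0 < l + x → ∀ δ > 0, ∀ᶠ q : ℕ × ℝ in atTop ×ˢ nhds x,
        ∀ t, t = Real.log ((F.sp (pn q.1) / epsP F (pn q.1) + q.2) /
          (F.sp (pn q.1) / epsP F (pn q.1))) → t < -Real.log (F.sp (pn q.1)) ∧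
        |limitProfile l t - emdenProfile (F.u (pn q.1)) (pn q.1) (F.sp (pn q.1))
          (F.u (pn q.1) (F.sp (pn q.1))) t| < δ ∧
        |limitSlope l t - emdenSlope (F.u (pn q.1)) (pn q.1) (F.sp (pn q.1))
          (F.u (pn q.1) (F.sp (pn q.1))) t| < δ := by
      intro x hx δ hδ
      set b := |Real.log ((l + x) / l)| + 1 with hb
      have hbpos : 0 < b := by positivity
      have habs : ∀ᶠ q : ℕ × ℝ in atTop ×ˢ nhds x, |Real.log
          ((F.sp (pn q.1) / epsP F (pn q.1) + q.2) / (F.sp (pn q.1) / epsP F (pn q.1)))| < b :=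
        (hτ x hx).abs.eventually_lt_const (lt_add_one _)
      filter_upwards [(tendsto_fst (f := atTop) (g := nhds x)).eventually
        (F.eventually_outer_close hpn hto hl hL hbpos hδ), habs] with q hq1 hq2 t ht
      rw [← ht, abs_lt] at hq2
      exact ⟨hq2.2.trans hq1.1, hq1.2.2 t ⟨hq2.1.le, hq2.2.le⟩⟩
    have hsumpos : ∀ x, 0 < l + x → ∀ᶠ q : ℕ × ℝ in atTop ×ˢ nhds x,
        0 < F.sp (pn q.1) / epsP F (pn q.1) + q.2 := fun x hx =>
      (hsum x).eventually_const_lt hx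
    constructor
    · refine tendstoUniformlyOn_of_tendsto_prod hK (fun x hx => ?_) (fun x hx => ?_)
      · exact (((hasDerivAt_limitProfile hl _).comp x
          (hlogd x (hpos x hx))).congr_of_eventuallyEq (hZev x (hpos x hx))).continuousAt
      · have h1 := (hcont.tendsto _).comp (hτ x (hpos x hx))
        rw [hZ x (hpos x hx)]
        refine h1.congr_dist (Metric.tendsto_nhds.2 fun δ hδ => ?_)
        filter_upwards [hclose x (hpos x hx) δ hδ, hsumpos x (hpos x hx)] with q hq1 hq2
        rw [Real.dist_0_eq_abs, abs_of_nonneg dist_nonneg, Real.dist_eq,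
          (F.zPlus_eq_emdenProfile (hpn q.1) rfl hq2).2]
        exact (hq1 _ rfl).2.1
    · refine tendstoUniformlyOn_of_tendsto_prod hK (fun x hx => ?_) (fun x hx => ?_)
      · have h1 : ContinuousAt (fun r => limitSlope l (Real.log ((l + r) / l)) / (l + r)) x :=
          (hcont'.continuousAt.comp (hlogd x (hpos x hx)).continuousAt).div
            (by fun_prop) (hpos x hx).ne'
        refine h1.congr ?_
        have : ∀ᶠ r in nhds x, 0 < l + r :=
          (continuousAt_const.add continuousAt_id).eventually (lt_mem_nhds (hpos x hx))
        filter_upwards [this] with r hr using (hZd r hr).symm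
      · have h1 := (hcont'.tendsto _).comp (hτ x (hpos x hx))
        have h2 : Tendsto (fun q : ℕ × ℝ => emdenSlope (F.u (pn q.1)) (pn q.1) (F.sp (pn q.1))
            (F.u (pn q.1) (F.sp (pn q.1))) (Real.log ((F.sp (pn q.1) / epsP F (pn q.1) + q.2) /
              (F.sp (pn q.1) / epsP F (pn q.1))))) (atTop ×ˢ nhds x)
            (nhds (limitSlope l (Real.log ((l + x) / l)))) := by
          refine h1.congr_dist (Metric.tendsto_nhds.2 fun δ hδ => ?_)
          filter_upwards [hclose x (hpos x hx) δ hδ] with q hq1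
          rw [Real.dist_0_eq_abs, abs_of_nonneg dist_nonneg, Real.dist_eq]
          exact (hq1 _ rfl).2.2
        rw [hZd x (hpos x hx)]
        refine (h2.div (hsum x) (hpos x hx).ne').congr' ?_
        filter_upwards [hclose x (hpos x hx) 1 one_pos, hsumpos x (hpos x hx)] with q hq1 hq2
        exact (F.deriv_zPlus (hpn q.1) rfl hq2 (hq1 _ rfl).1).symm
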